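/- Let M be a graded D-module over R = k[x_1,…,x_n] that is Eulerian, i.e., Σ_{i=1}^n x_i·∂_i^M(z) = l·z for every l ∈ ℤ and every z ∈ M_l. Then the graded Matlis dual DD(M) is Eulerian: for every l ∈ ℤ and every λ ∈ DD(M)_l one has Σ_{i=1}^n x_i·(∂_i·λ) = l·λ. -/

import Mathlib

/-!
Statement 6: the graded Matlis dual of an Eulerian graded `D`-module is Eulerian.
-/

open MvPolynomial
open scoped DirectSum

set_option maxHeartbeats 2000000
set_option synthInstance.maxHeartbeats 1000000

section MatlisDual

variable {k : Type} [Field k] {n : ℕ} {M : Type} [AddCommGroup M] [Module k M]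

/-- The carrier of the graded Matlis dual `DD(M)`, with `DD(M)_l = Hom_k(M_{-l-n}, k)`. -/
abbrev DDcar (deg : ℤ → Submodule k M) (n : ℕ) : Type :=
  @DirectSum ℤ (fun l => Module.Dual k ↥(deg (-l - (n : ℤ))))
    (fun l => (inferInstance :
      AddCommGroup (Module.Dual k ↥(deg (-l - (n : ℤ))))).toAddCommMonoid)

/-- Projection of `M` onto its degree-`l` component. -/
noncomputable def gproj (deg : ℤ → Submodule k M) (hint : DirectSum.IsInternal deg) (l : ℤ) :
    M →ₗ[k] ↥(deg l) :=
  (DirectSum.component k ℤ (fun j => ↥(deg j)) l).comp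
    (LinearEquiv.ofBijective (DirectSum.coeLinearMap deg) hint).symm.toLinearMap

/-- The evaluation pairing between `DD(M)` and `M` (injective in the first variable,
hence characterizing the actions on `DD(M)` uniquely). -/
noncomputable def gev (deg : ℤ → Submodule k M) (hint : DirectSum.IsInternal deg) :
    DDcar deg n →ₗ[k] Module.Dual k M :=
  DirectSum.toModule k ℤ (Module.Dual k M)
    (fun l => (gproj deg hint (-l - (n : ℤ))).dualMap)

/-- The degree-`l` component of the graded Matlis dual. -/
noncomputable def DDdeg (deg : ℤ → Submodule k M) (n : ℕ) (l : ℤ) :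
    Submodule k (DDcar deg n) :=
  LinearMap.range (DirectSum.lof k ℤ (fun j => Module.Dual k ↥(deg (-j - (n : ℤ)))) l)

end MatlisDual

section MatlisDualPairing

variable {k : Type} [Field k] {n : ℕ} {M : Type} [AddCommGroup M] [Module k M]

theorem gproj_of_mem (deg : ℤ → Submodule k M) (hint : DirectSum.IsInternal deg) {j : ℤ}
    (m : deg j) : gproj deg hint j (m : M) = m := by
  have h : (LinearEquiv.ofBijective (DirectSum.coeLinearMap deg) hint).symm (m : M)
      = DirectSum.lof k ℤ (fun j => ↥(deg j)) j m := by
    rw [LinearEquiv.symm_apply_eq]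
    exact (DirectSum.coeLinearMap_lof deg _ _).symm
  simp [gproj, h, DirectSum.component.lof_self]

theorem gproj_of_mem_ne (deg : ℤ → Submodule k M) (hint : DirectSum.IsInternal deg) {i j : ℤ}
    (hij : i ≠ j) {m : M} (hm : m ∈ deg j) : gproj deg hint i m = 0 := by
  have h : (LinearEquiv.ofBijective (DirectSum.coeLinearMap deg) hint).symm m
      = DirectSum.lof k ℤ (fun j => ↥(deg j)) j ⟨m, hm⟩ := by
    rw [LinearEquiv.symm_apply_eq]
    exact (DirectSum.coeLinearMap_lof deg j ⟨m, hm⟩).symm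
  simp [gproj, h, DirectSum.component.of, hij.symm]

theorem gev_lof (deg : ℤ → Submodule k M) (hint : DirectSum.IsInternal deg) (l : ℤ)
    (φ : Module.Dual k ↥(deg (-l - (n : ℤ)))) (m : M) :
    gev deg hint (DirectSum.lof k ℤ (fun j => Module.Dual k ↥(deg (-j - (n : ℤ)))) l φ) m
      = φ (gproj deg hint (-l - (n : ℤ)) m) := by
  simp [gev, DirectSum.toModule_lof]

theorem gev_apply_of_mem (deg : ℤ → Submodule k M) (hint : DirectSum.IsInternal deg)
    (lam : DDcar deg n) (l : ℤ) (m : deg (-l - (n : ℤ))) :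
    gev deg hint lam (m : M) = lam l m := by
  induction lam using DirectSum.induction_on with
  | zero => simp
  | add a b ha hb => simp [ha, hb]
  | of j φ =>
    refine (gev_lof deg hint j φ m).trans ?_
    by_cases hjl : j = l
    · subst hjl
      rw [gproj_of_mem, DirectSum.of_eq_same]
    · rw [gproj_of_mem_ne deg hint (by omega) m.2, DirectSum.of_eq_of_ne _ _ _ (Ne.symm hjl)]
      simp

theorem gev_injective (deg : ℤ → Submodule k M) (hint : DirectSum.IsInternal deg) :
    Function.Injective (gev (n := n) deg hint) := by
  intro a b hab
  refine DFinsupp.ext fun l => LinearMap.ext fun m => ?_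
  rw [← gev_apply_of_mem deg hint a, ← gev_apply_of_mem deg hint b, hab]

/-- Linear forms on an internally graded module agree once they agree on homogeneous elements. -/
theorem dual_ext_of_isInternal (deg : ℤ → Submodule k M) (hint : DirectSum.IsInternal deg)
    {f g : Module.Dual k M} (h : ∀ j, ∀ m ∈ deg j, f m = g m) : f = g := by
  refine LinearMap.ext fun m => ?_
  have hm : m ∈ ⨆ j, deg j := hint.submodule_iSup_eq_top ▸ Submodule.mem_top
  induction hm using Submodule.iSup_induction' with
  | mem j x hx => exact h j x hx
  | zero => simp
  | add x y _ _ hx hy => simp [hx, hy]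

end MatlisDualPairing

/-- If `M` is an Eulerian graded `D`-module over `R = k[x₁,…,xₙ]`
(i.e. `Σ_i x_i·∂_i(z) = l·z` for homogeneous `z` of degree `l`), then the graded Matlis
dual `DD(M)` — whose `R`-action `ρ` and `∂`-actions `Dpd` are characterized by
`⟨f·λ, m⟩ = ⟨λ, f·m⟩` and `⟨∂_i·λ, m⟩ = -⟨λ, ∂_i m⟩` — is Eulerian as well. -/
theorem graded_Matlis_dual_of_Eulerian_is_Eulerian
    {k : Type} [Field k] [CharZero k] {n : ℕ} (hn : 0 < n)
    {M : Type} [AddCommGroup M] [Module k M]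
    [Module (MvPolynomial (Fin n) k) M] [IsScalarTower k (MvPolynomial (Fin n) k) M]
    (pd : Fin n → Module.End k M)
    (hcomm : ∀ i j, Commute (pd i) (pd j))
    (hleib : ∀ (i : Fin n) (f : MvPolynomial (Fin n) k) (m : M),
      pd i (f • m) = (pderiv i f) • m + f • (pd i m))
    (deg : ℤ → Submodule k M)
    (hint : DirectSum.IsInternal deg)
    (hsmul : ∀ (d : ℕ) (f : MvPolynomial (Fin n) k), f.IsHomogeneous d →
      ∀ (l : ℤ), ∀ m ∈ deg l, f • m ∈ deg (l + d))
    (hpd : ∀ (i : Fin n) (l : ℤ), ∀ m ∈ deg l, pd i m ∈ deg (l - 1))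
    (ρ : MvPolynomial (Fin n) k →ₐ[k] Module.End k (DDcar deg n))
    (hρ : ∀ (f : MvPolynomial (Fin n) k) (lam : DDcar deg n) (m : M),
      gev deg hint (ρ f lam) m = gev deg hint lam (f • m))
    (Dpd : Fin n → Module.End k (DDcar deg n))
    (hDpd : ∀ (i : Fin n) (lam : DDcar deg n) (m : M),
      gev deg hint (Dpd i lam) m = - gev deg hint lam (pd i m))
    (hEuler : ∀ (l : ℤ), ∀ z ∈ deg l,
      (∑ i : Fin n, (X i : MvPolynomial (Fin n) k) • (pd i z)) = l • z) :
    ∀ (l : ℤ), ∀ lam ∈ DDdeg deg n l,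
      (∑ i : Fin n, ρ (X i) (Dpd i lam)) = l • lam := by
  intro l lam hlam
  obtain ⟨φ, rfl⟩ := hlam
  refine gev_injective deg hint (dual_ext_of_isInternal deg hint fun j m hm => ?_)
  have hsum : ∑ i : Fin n, pd i ((X i : MvPolynomial (Fin n) k) • m) = ((n : ℤ) + j) • m := by
    simp only [hleib, pderiv_X_self, one_smul, Finset.sum_add_distrib, hEuler j m hm]
    simp [add_smul]
  rw [map_sum, LinearMap.sum_apply]
  simp only [hρ, hDpd]
  rw [Finset.sum_neg_distrib, ← map_sum, hsum, map_zsmul, map_zsmul, LinearMap.smul_apply,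
    gev_lof, ← neg_smul]
  by_cases hj : -l - (n : ℤ) = j
  · congr 1
    omega
  · simp [gproj_of_mem_ne deg hint hj hm]
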